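/- Let V be an n × n integer matrix, a a 1 × n integer row vector, and W = [[V, 0, 0], [a, 0, 0], [0, 1, 0]] the row-type elementary enlargement of V. Let Q be the (n+2) × (n+2) block matrix Q = [[I_n, 0, −aᵀ], [0, 1, 0], [0, 0, 1]]. Then Q·(W + Wᵀ)·Qᵀ equals the block-diagonal matrix with blocks V + Vᵀ and [[0, 1], [1, 0]]. -/

import Mathlib

open Matrix

/-- The row-type elementary enlargement `W = [[V, 0, 0], [a, 0, 0], [0, 1, 0]]`. -/
def rowEnlarge {n : ℕ} (V : Matrix (Fin n) (Fin n) ℤ) (a : Fin n → ℤ) :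
    Matrix (Fin n ⊕ Fin 2) (Fin n ⊕ Fin 2) ℤ :=
  Matrix.fromBlocks V 0
    (Matrix.of fun (i : Fin 2) (j : Fin n) => if i = 0 then a j else 0)
    !![0, 0; 1, 0]

/-- With `Q = [[I_n, 0, −aᵀ], [0, 1, 0], [0, 0, 1]]` and `W` the row-type elementary
enlargement of `V` by `a`, we have
`Q·(W + Wᵀ)·Qᵀ = (V + Vᵀ) ⊕ [[0, 1], [1, 0]]` (block diagonal). -/
theorem conj_symmetrized_rowEnlarge {n : ℕ} (V : Matrix (Fin n) (Fin n) ℤ)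
    (a : Fin n → ℤ)
    (Q : Matrix (Fin n ⊕ Fin 2) (Fin n ⊕ Fin 2) ℤ)
    (hQ : Q = Matrix.fromBlocks 1
      (Matrix.of fun (i : Fin n) (j : Fin 2) => if j = 1 then -(a i) else 0)
      0 1) :
    Q * (rowEnlarge V a + (rowEnlarge V a)ᵀ) * Qᵀ
      = Matrix.fromBlocks (V + Vᵀ) 0 0 !![0, 1; 1, 0] := by
  subst hQ
  rw [rowEnlarge, fromBlocks_transpose, fromBlocks_add, fromBlocks_transpose,
    fromBlocks_multiply, fromBlocks_multiply, fromBlocks_inj]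
  refine ⟨?_, ?_, ?_, ?_⟩
  · ext i j
    simp [Matrix.mul_apply, Matrix.add_mul]
  · ext i j
    fin_cases j <;> simp [Matrix.mul_apply]
  · ext i j
    fin_cases i <;> simp [Matrix.mul_apply]
  · ext i j
    fin_cases i <;> fin_cases j <;> simp
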